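/- arXiv:2106.09116 — 2 statements merged into one kernel-verified Lean document; each statement's English description precedes it below -/
import Mathlib

section
/- Kite K₁ case of Theorem 1.3: Let x, y be real numbers such that y, (√2/2)(x + y), √2·(x - 1/2), and √2·((√2/2)(x - y) - 1/2) are all rational. Then y = -1/2 and x = 1/2 + √2/2. -/
/-- A rational multiple of `√2` is rational only if the coefficient vanishes. -/
theorem eq_zero_of_ratCast_mul_sqrt_two_eq_ratCast {a b : ℚ}
    (h : (b : ℝ) * Real.sqrt 2 = (a : ℝ)) : b = 0 := by
  by_contra hb
  exact irrational_sqrt_two.ratCast_mul hb ⟨a, h.symm⟩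

/-- Kite `K₁` case of Theorem 1.3: if `y`, `(√2/2)(x + y)`, `√2(x - 1/2)` and
`√2((√2/2)(x - y) - 1/2)` are all rational, then `y = -1/2` and `x = 1/2 + √2/2`. -/
theorem kite_K1_case (x y : ℝ)
    (hy : ∃ q : ℚ, y = (q : ℝ))
    (h1 : ∃ q : ℚ, Real.sqrt 2 / 2 * (x + y) = (q : ℝ))
    (h2 : ∃ q : ℚ, Real.sqrt 2 * (x - 1 / 2) = (q : ℝ))
    (h3 : ∃ q : ℚ, Real.sqrt 2 * (Real.sqrt 2 / 2 * (x - y) - 1 / 2) = (q : ℝ)) :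
    y = -1 / 2 ∧ x = 1 / 2 + Real.sqrt 2 / 2 := by
  obtain ⟨p, hp⟩ := hy
  obtain ⟨q, hq⟩ := h1
  obtain ⟨r, hr⟩ := h2
  obtain ⟨t, ht⟩ := h3
  have hs : Real.sqrt 2 * Real.sqrt 2 = 2 := Real.mul_self_sqrt (by norm_num)
  have hx : x = 1 / 2 + r * Real.sqrt 2 / 2 := by
    linear_combination (1 / 2 - x) / 2 * hs + Real.sqrt 2 / 2 * hr
  subst hp hx
  have hp : p + 1 / 2 = 0 := by
    refine eq_zero_of_ratCast_mul_sqrt_two_eq_ratCast (a := 2 * q - r) ?_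
    push_cast
    linear_combination 2 * hq - r / 2 * hs
  obtain rfl : p = -1 / 2 := by linarith
  have hr : r - 1 = 0 := by
    refine eq_zero_of_ratCast_mul_sqrt_two_eq_ratCast (a := 2 * t - 2) ?_
    push_cast at ht ⊢
    linear_combination 2 * ht - (1 + r * Real.sqrt 2 / 2) * hs
  obtain rfl : r = 1 := by linarith
  norm_num
end

section
/- Four-rotation origin lemma (Case 1a of Theorems 5.1, 6.1 and 1.4): Let θ be a real number with sin θ ≠ 0 and cos θ irrational, and let x, y be real numbers such that for each k ∈ {-1, 0, 1, 2} the quantity (x·sin(kθ) + y·cos(kθ))/sin θ is rational. Then x = 0 and y = 0. -/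
/-- If `2 * c * d` is a sum of rationals with `c` irrational and `d` rational, then `d = 0`. -/
theorem Irrational.eq_zero_of_two_mul_mul_eq {c : ℝ} (hc : Irrational c) {a b d : ℚ}
    (h : (a : ℝ) + b = 2 * c * d) : d = 0 := by
  by_contra hd
  have hd' : (d : ℝ) ≠ 0 := by exact_mod_cast hd
  refine hc ⟨(a + b) / (2 * d), ?_⟩
  push_cast
  rw [h]
  field_simp

/-- Four-rotation origin lemma: if `sin θ ≠ 0`, `cos θ` is irrational, and for each
`k ∈ {-1, 0, 1, 2}` the quantity `(x sin(kθ) + y cos(kθ))/sin θ` is rational, then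
`x = 0` and `y = 0`. -/
theorem four_rotation_origin (θ : ℝ) (hs : Real.sin θ ≠ 0)
    (hc : Irrational (Real.cos θ)) (x y : ℝ)
    (h : ∀ k : ℤ, k ∈ ({-1, 0, 1, 2} : Set ℤ) →
      ∃ q : ℚ, (x * Real.sin ((k : ℝ) * θ) + y * Real.cos ((k : ℝ) * θ)) / Real.sin θ
        = (q : ℝ)) :
    x = 0 ∧ y = 0 := by
  obtain ⟨p, hp⟩ := h (-1) (by simp)
  obtain ⟨q, hq⟩ := h 0 (by simp)
  obtain ⟨r, hr⟩ := h 1 (by simp)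
  obtain ⟨t, ht⟩ := h 2 (by simp)
  push_cast at hp hq hr ht
  simp only [neg_mul, one_mul, zero_mul, Real.sin_neg, Real.cos_neg, Real.sin_zero,
    Real.cos_zero, Real.sin_two_mul, Real.cos_two_mul] at hp hq hr ht
  have hq0 : q = 0 := hc.eq_zero_of_two_mul_mul_eq (a := p) (b := r) (by
    rw [← hp, ← hq, ← hr]; field_simp; ring)
  have hr0 : r = 0 := hc.eq_zero_of_two_mul_mul_eq (a := q) (b := t) (by
    rw [← hq, ← hr, ← ht]; field_simp; ring)
  have hy : y = 0 := by simpa [hq0, hs] using hq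
  have hx : x = 0 := by simpa [hr0, hs, hy] using hr
  exact ⟨hx, hy⟩
end
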